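/- First variation of the KL entropy transport functional: let ρ > 0 be a probability density on ℝ^d × ℝ^d with marginal densities ρ₁(x) = ∫ρ(x,y)dy and ρ₂(y) = ∫ρ(x,y)dx, let ϱ₁, ϱ₂ be the (positive) densities of μ, ν, and write E(ρ) = ∬ (c(x,y) + Λ log(ρ₁(x)/ϱ₁(x)) + Λ log(ρ₂(y)/ϱ₂(y))) ρ(x,y) dx dy. Then for every compactly supported continuous perturbation σ on ℝ^d × ℝ^d (with marginals σ₁, σ₂), d/dh E(ρ + hσ) at h = 0 equals ∬ (2Λ + c(x,y) + Λ log(ρ₁(x)/ϱ₁(x)) + Λ log(ρ₂(y)/ϱ₂(y))) σ(x,y) dx dy; i.e. the L² functional derivative of E at ρ is δE/δρ (x,y) = 2Λ + c(x,y) + Λ log(ρ₁(x)/ϱ₁(x)) + Λ log(ρ₂(y)/ϱ₂(y)). -/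

import Mathlib

open MeasureTheory ENNReal Filter

/-- First marginal density `ρ₁(x) = ∫ ρ(x,y) dy`. -/
noncomputable def marg1 {d : ℕ}
    (f : EuclideanSpace ℝ (Fin d) × EuclideanSpace ℝ (Fin d) → ℝ)
    (x : EuclideanSpace ℝ (Fin d)) : ℝ :=
  ∫ y, f (x, y)

/-- Second marginal density `ρ₂(y) = ∫ ρ(x,y) dx`. -/
noncomputable def marg2 {d : ℕ}
    (f : EuclideanSpace ℝ (Fin d) × EuclideanSpace ℝ (Fin d) → ℝ)
    (y : EuclideanSpace ℝ (Fin d)) : ℝ :=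
  ∫ x, f (x, y)

/-- The KL entropy transport functional expressed in terms of densities:
`E(ρ) = ∬ (c(x,y) + Λ log(ρ₁(x)/ϱ₁(x)) + Λ log(ρ₂(y)/ϱ₂(y))) ρ(x,y) dx dy`. -/
noncomputable def EfunKL {d : ℕ} (Λ : ℝ)
    (c : EuclideanSpace ℝ (Fin d) × EuclideanSpace ℝ (Fin d) → ℝ)
    (ϱ₁ ϱ₂ : EuclideanSpace ℝ (Fin d) → ℝ)
    (f : EuclideanSpace ℝ (Fin d) × EuclideanSpace ℝ (Fin d) → ℝ) : ℝ :=
  ∫ p, (c p + Λ * Real.log (marg1 f p.1 / ϱ₁ p.1)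
      + Λ * Real.log (marg2 f p.2 / ϱ₂ p.2)) * f p

lemma klv_psi_bound (t : ℝ) :
    |(1 + t) * Real.log (1 + t)| ≤ |t| * (1 + Real.log (1 + |t|)) := by
  have hL0 : 0 ≤ Real.log (1 + |t|) := Real.log_nonneg (by linarith [abs_nonneg t])
  have hR : 0 ≤ |t| * (1 + Real.log (1 + |t|)) := by positivity
  rw [abs_mul, ← Real.log_abs (1 + t)]
  set u := |1 + t| with hu
  have hu0 : 0 ≤ u := abs_nonneg _
  have hu1 : u ≤ 1 + |t| := by
    rw [hu]; exact (abs_add_le _ _).trans (by simp)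
  have hu2 : 1 - |t| ≤ u := by
    have := abs_sub_abs_le_abs_sub (1 : ℝ) (-t)
    simpa [hu] using this
  rcases hu0.eq_or_lt with h0 | h0
  · rw [← h0]; simpa using hR
  · rcases le_total 1 u with h1 | h1
    · rw [abs_of_nonneg (Real.log_nonneg h1)]
      have h2 : Real.log u ≤ Real.log (1 + |t|) := Real.log_le_log h0 hu1
      have h3 : Real.log (1 + |t|) ≤ |t| := by
        have := Real.log_le_sub_one_of_pos (x := 1 + |t|) (by positivity)
        linarith
      nlinarith [mul_le_mul hu1 h2 (Real.log_nonneg h1) (by positivity)]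
    · rw [abs_of_nonpos (Real.log_nonpos hu0 h1)]
      have h2 := Real.log_le_sub_one_of_pos (x := u⁻¹) (by positivity)
      rw [Real.log_inv] at h2
      have h3 : u * -Real.log u ≤ u * (u⁻¹ - 1) := by gcongr
      have h4 : u * (u⁻¹ - 1) = 1 - u := by field_simp
      nlinarith [mul_nonneg (abs_nonneg t) hL0]

/-- clipping to `[-n, n]` -/
noncomputable def klv_clip (n : ℕ) (t : ℝ) : ℝ := max (-(n : ℝ)) (min t n)

lemma klv_clip_meas (n : ℕ) : Measurable (klv_clip n) := by
  unfold klv_clip; fun_prop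

lemma klv_clip_abs_le (n : ℕ) (t : ℝ) : |klv_clip n t| ≤ n := by
  have : (0 : ℝ) ≤ n := Nat.cast_nonneg n
  unfold klv_clip
  rw [abs_le]
  exact ⟨le_max_left _ _, max_le (by linarith) (min_le_right _ _)⟩

lemma klv_clip_abs_le' (n : ℕ) (t : ℝ) : |klv_clip n t| ≤ |t| := by
  have : (0 : ℝ) ≤ n := Nat.cast_nonneg n
  unfold klv_clip
  grind

lemma klv_clip_add (n : ℕ) (s t : ℝ) : |klv_clip n s + klv_clip n t| ≤ |s + t| := by
  have : (0 : ℝ) ≤ n := Nat.cast_nonneg n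
  unfold klv_clip
  grind

lemma klv_clip_eq (t : ℝ) : ∀ᶠ n : ℕ in atTop, klv_clip n t = t := by
  filter_upwards [eventually_ge_atTop (Nat.ceil |t|)] with n hn
  have : |t| ≤ n := (Nat.le_ceil _).trans (by exact_mod_cast hn)
  unfold klv_clip
  rw [abs_le] at this
  rw [min_eq_left this.2, max_eq_right this.1]

lemma klv_deriv {α : Type*} [MeasurableSpace α] {μ : Measure α} (a b : α → ℝ)
    (ha : Measurable a) (hb : Measurable b) (hapos : ∀ᵐ x ∂μ, 0 < a x)
    (hbi : Integrable b μ)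
    (hL : Integrable (fun x => Real.log (1 + |b x / a x|) * b x) μ) :
    (∀ h : ℝ, |h| ≤ 1 → Integrable (fun x => Real.log (1 + h * (b x / a x)) * (a x + h * b x)) μ) ∧
    HasDerivAt (fun h : ℝ => ∫ x, Real.log (1 + h * (b x / a x)) * (a x + h * b x) ∂μ)
      (∫ x, b x ∂μ) 0 := by
  have hm : ∀ h : ℝ, AEStronglyMeasurable
      (fun x => Real.log (1 + h * (b x / a x)) * (a x + h * b x)) μ := fun h =>
    Measurable.aestronglyMeasurable (by fun_prop)
  have hbd : Integrable (fun x => |b x| + |Real.log (1 + |b x / a x|) * b x|) μ :=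
    hbi.abs.add hL.abs
  have key : ∀ᵐ x ∂μ, ∀ h : ℝ, |h| ≤ 1 →
      |Real.log (1 + h * (b x / a x)) * (a x + h * b x)| ≤
        (|b x| + |Real.log (1 + |b x / a x|) * b x|) * |h| := by
    filter_upwards [hapos] with x hx h hh
    set r := b x / a x with hr
    have hbx : b x = a x * r := by rw [hr]; field_simp
    have h1 : Real.log (1 + h * r) * (a x + h * b x)
        = a x * ((1 + h * r) * Real.log (1 + h * r)) := by rw [hbx]; ring
    have h2 : Real.log (1 + |h * r|) ≤ Real.log (1 + |r|) := by
      apply Real.log_le_log (by positivity)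
      rw [abs_mul]; nlinarith [abs_nonneg r]
    have h0 : 0 ≤ Real.log (1 + |r|) := Real.log_nonneg (by linarith [abs_nonneg r])
    rw [h1, abs_mul, abs_of_pos hx, abs_mul (Real.log _), abs_of_nonneg h0, hbx, abs_mul (a x),
      abs_of_pos hx]
    calc a x * |(1 + h * r) * Real.log (1 + h * r)|
        ≤ a x * (|h * r| * (1 + Real.log (1 + |h * r|))) := by gcongr; exact klv_psi_bound _
      _ ≤ a x * (|h * r| * (1 + Real.log (1 + |r|))) := by gcongr
      _ = _ := by rw [abs_mul]; ring
  refine ⟨fun h hh => ?_, ?_⟩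
  · refine (hbd.mul_const |h|).mono' (hm h) ?_
    filter_upwards [key] with x hx using hx h hh
  · have main := hasFDerivAt_integral_of_dominated_loc_of_lip' (μ := μ) (𝕜 := ℝ)
      (F := fun (h : ℝ) x => Real.log (1 + h * (b x / a x)) * (a x + h * b x))
      (F' := fun x => ContinuousLinearMap.toSpanSingleton ℝ (b x)) (x₀ := 0) (s := Metric.ball 0 1)
      (bound := fun x => |b x| + |Real.log (1 + |b x / a x|) * b x|)
      (Metric.ball_mem_nhds _ one_pos) (fun h _ => hm h) (by simp)
      ((ContinuousLinearMap.toSpanSingletonCLE (𝕜 := ℝ) (E := ℝ)).continuous.comp_aestronglyMeasurable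
        hb.aestronglyMeasurable) ?_ hbd ?_
    · have h2 := main.2.hasDerivAt
      rw [ContinuousLinearMap.integral_apply main.1] at h2
      simpa using h2
    · filter_upwards [key] with x hx h hh
      have := hx h (by simpa using (Metric.mem_ball.1 hh).le)
      simpa using this
    · filter_upwards [hapos] with x hx
      have d1 : HasDerivAt (fun h : ℝ => 1 + h * (b x / a x)) (b x / a x) 0 := by
        simpa using ((hasDerivAt_id (0 : ℝ)).mul_const (b x / a x)).const_add 1
      have d2 : HasDerivAt (fun h : ℝ => a x + h * b x) (b x) 0 := by
        simpa using ((hasDerivAt_id (0 : ℝ)).mul_const (b x)).const_add (a x)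
      have d3 := (d1.log (by simp)).mul d2
      have e : b x / a x / (1 + 0 * (b x / a x)) * (a x + 0 * b x)
          + Real.log (1 + 0 * (b x / a x)) * b x = b x := by
        simp; field_simp
      rw [e] at d3
      exact d3.hasFDerivAt

lemma klv_trunc {α β : Type*} [MeasurableSpace α] [MeasurableSpace β] {μ : Measure α}
    {ν : Measure β} [SFinite μ] [SFinite ν] (w : α × β → ℝ) (hw : Integrable w (μ.prod ν))
    (φ φ0 : α → ℝ) (ψ ψ0 : β → ℝ) (hφ : Measurable φ) (hψ : Measurable ψ)
    (w1 : α → ℝ) (w2 : β → ℝ) (hw1 : ∀ᵐ x ∂μ, w1 x = ∫ y, w (x, y) ∂ν)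
    (hw2 : ∀ᵐ y ∂ν, w2 y = ∫ x, w (x, y) ∂μ)
    (hi : Integrable (fun p => (φ p.1 + ψ p.2) * w p) (μ.prod ν))
    (h1 : ∀ᵐ x ∂μ, w1 x ≠ 0 → φ x = φ0 x) (h2 : ∀ᵐ y ∂ν, w2 y ≠ 0 → ψ y = ψ0 y)
    (hi1 : Integrable (fun x => φ0 x * w1 x) μ) (hi2 : Integrable (fun y => ψ0 y * w2 y) ν) :
    ∫ p, (φ p.1 + ψ p.2) * w p ∂(μ.prod ν) = ∫ x, φ0 x * w1 x ∂μ + ∫ y, ψ0 y * w2 y ∂ν := by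
  have i1 : ∀ n : ℕ, Integrable (fun p : α × β => klv_clip n (φ p.1) * w p) (μ.prod ν) := fun n =>
    hw.bdd_mul (c := n) ((klv_clip_meas n).comp (hφ.comp measurable_fst)).aestronglyMeasurable
      (ae_of_all _ fun p => klv_clip_abs_le n _)
  have i2 : ∀ n : ℕ, Integrable (fun p : α × β => klv_clip n (ψ p.2) * w p) (μ.prod ν) := fun n =>
    hw.bdd_mul (c := n) ((klv_clip_meas n).comp (hψ.comp measurable_snd)).aestronglyMeasurable
      (ae_of_all _ fun p => klv_clip_abs_le n _)
  have L : Tendsto (fun n : ℕ => ∫ p, (klv_clip n (φ p.1) + klv_clip n (ψ p.2)) * w p ∂(μ.prod ν))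
      atTop (nhds (∫ p, (φ p.1 + ψ p.2) * w p ∂(μ.prod ν))) := by
    refine tendsto_integral_of_dominated_convergence (fun p => |(φ p.1 + ψ p.2) * w p|)
      (fun n => ?_) hi.abs (fun n => ae_of_all _ fun p => ?_) (ae_of_all _ fun p => ?_)
    · simp_rw [add_mul]
      exact ((i1 n).add (i2 n)).aestronglyMeasurable
    · rw [Real.norm_eq_abs, abs_mul, abs_mul]
      exact mul_le_mul_of_nonneg_right (klv_clip_add n _ _) (abs_nonneg _)
    · apply tendsto_const_nhds.congr'
      filter_upwards [klv_clip_eq (φ p.1), klv_clip_eq (ψ p.2)] with n e1 e2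
      rw [e1, e2]
  have w1m : AEStronglyMeasurable w1 μ :=
    hw.integral_prod_left.aestronglyMeasurable.congr (by filter_upwards [hw1] with x hx using hx.symm)
  have w2m : AEStronglyMeasurable w2 ν :=
    hw.integral_prod_right.aestronglyMeasurable.congr (by filter_upwards [hw2] with x hx using hx.symm)
  have R1 : Tendsto (fun n : ℕ => ∫ x, klv_clip n (φ x) * w1 x ∂μ) atTop
      (nhds (∫ x, φ0 x * w1 x ∂μ)) := by
    refine tendsto_integral_of_dominated_convergence (fun x => |φ0 x * w1 x|)
      (fun n => ((klv_clip_meas n).comp hφ).aestronglyMeasurable.mul w1m) hi1.abs (fun n => ?_) ?_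
    · filter_upwards [h1] with x hx
      by_cases h : w1 x = 0
      · simp [h]
      · rw [Real.norm_eq_abs, abs_mul, abs_mul, hx h]
        exact mul_le_mul_of_nonneg_right (klv_clip_abs_le' n _) (abs_nonneg _)
    · filter_upwards [h1] with x hx
      apply tendsto_const_nhds.congr'
      filter_upwards [klv_clip_eq (φ x)] with n e1
      by_cases h : w1 x = 0
      · simp [h]
      · rw [e1, hx h]
  have R2 : Tendsto (fun n : ℕ => ∫ x, klv_clip n (ψ x) * w2 x ∂ν) atTop
      (nhds (∫ x, ψ0 x * w2 x ∂ν)) := by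
    refine tendsto_integral_of_dominated_convergence (fun x => |ψ0 x * w2 x|)
      (fun n => ((klv_clip_meas n).comp hψ).aestronglyMeasurable.mul w2m) hi2.abs (fun n => ?_) ?_
    · filter_upwards [h2] with x hx
      by_cases h : w2 x = 0
      · simp [h]
      · rw [Real.norm_eq_abs, abs_mul, abs_mul, hx h]
        exact mul_le_mul_of_nonneg_right (klv_clip_abs_le' n _) (abs_nonneg _)
    · filter_upwards [h2] with x hx
      apply tendsto_const_nhds.congr'
      filter_upwards [klv_clip_eq (ψ x)] with n e1
      by_cases h : w2 x = 0
      · simp [h]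
      · rw [e1, hx h]
  refine tendsto_nhds_unique L ((R1.add R2).congr fun n => ?_)
  simp_rw [add_mul]
  rw [integral_add (i1 n) (i2 n), integral_prod _ (i1 n), integral_prod_symm _ (i2 n)]
  congr 1
  · apply integral_congr_ae
    filter_upwards [hw1] with x hx
    rw [hx, ← integral_const_mul]
  · apply integral_congr_ae
    filter_upwards [hw2] with x hx
    rw [hx, ← integral_const_mul]

lemma klv_pt (r s ρ σ A1 B1 A4 B4 : ℝ) (hρ : 0 < ρ)
    (hA1 : 1 + r ≠ 0 → A1 = Real.log (1 + r)) (hB1 : 1 + s ≠ 0 → B1 = Real.log (1 + s))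
    (hA4 : 1 + 4 * r ≠ 0 → A4 = Real.log (1 + 4 * r))
    (hB4 : 1 + 4 * s ≠ 0 → B4 = Real.log (1 + 4 * s)) :
    |Real.log (1 + |r|) * σ| ≤ |(A1 + B1) * (ρ + σ)| + |(A4 + B4) * (ρ + 4 * σ)|
      + 3 * (ρ + |σ|) + |r| * ρ := by
  set L := Real.log (1 + |r|) with hLd
  have hL0 : 0 ≤ L := Real.log_nonneg (by linarith [abs_nonneg r])
  have hLr : L ≤ |r| := by
    have := Real.log_le_sub_one_of_pos (x := 1 + |r|) (by positivity)
    linarith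
  have e1 : |σ| ≤ |ρ + σ| + ρ := by
    have := abs_sub (ρ + σ) ρ
    rw [abs_of_pos hρ] at this
    simpa using this
  have e1' : |ρ + σ| ≤ ρ + |σ| := by
    simpa [abs_of_pos hρ] using abs_add_le ρ σ
  have e4 : |σ| ≤ |ρ + 4 * σ| + ρ := by
    have := abs_sub (ρ + 4 * σ) ρ
    rw [abs_of_pos hρ] at this
    simp [abs_mul] at this
    linarith [abs_nonneg σ]
  rw [abs_mul, abs_mul, abs_mul, abs_of_nonneg hL0]
  have p1 : 0 ≤ |A1 + B1| * |ρ + σ| := by positivity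
  have p4 : 0 ≤ |A4 + B4| * |ρ + 4 * σ| := by positivity
  have pr : 0 ≤ |r| * ρ := by positivity
  have hLρ : L * ρ ≤ |r| * ρ := by gcongr
  rcases le_or_gt |r| 2 with hr | hr
  · nlinarith [abs_nonneg σ]
  · rcases le_or_gt |s| (1 / 2) with hs | hs
    · have hr1 : |r| - 1 ≤ |1 + r| := by grind
      rw [abs_le] at hs
      rw [hB1 (by linarith), hA1 (by intro h; rw [h] at hr1; simp at hr1; linarith)] at *
      have l1 : L ≤ Real.log 3 + Real.log (1 + r) := by
        rw [← Real.log_abs (1 + r), ← Real.log_mul (by norm_num) (by linarith)]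
        apply Real.log_le_log (by positivity)
        linarith
      have l2 : -1 ≤ Real.log (1 + s) := by
        have := Real.one_sub_inv_le_log_of_pos (x := 1 + s) (by linarith)
        have h3 : (1 + s)⁻¹ ≤ 2 := by
          rw [inv_le_comm₀ (by linarith) (by norm_num)]; linarith
        linarith
      have l3 : Real.log 3 ≤ 2 := by
        have := Real.log_le_sub_one_of_pos (x := 3) (by norm_num)
        linarith
      have l4 : L ≤ 3 + |Real.log (1 + r) + Real.log (1 + s)| := by
        linarith [le_abs_self (Real.log (1 + r) + Real.log (1 + s))]
      nlinarith [mul_le_mul_of_nonneg_left e1 hL0, mul_le_mul_of_nonneg_right l4 (abs_nonneg (ρ + σ))]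
    · have hr1 : 1 + |r| ≤ |1 + 4 * r| := by grind
      have hs1 : 1 ≤ |1 + 4 * s| := by grind
      rw [hB4 (by intro h; rw [h] at hs1; simp at hs1; linarith),
        hA4 (by intro h; rw [h] at hr1; simp at hr1; linarith [abs_nonneg r])] at *
      have l1 : L ≤ Real.log (1 + 4 * r) := by
        rw [← Real.log_abs (1 + 4 * r)]
        exact Real.log_le_log (by positivity) hr1
      have l2 : 0 ≤ Real.log (1 + 4 * s) := by
        rw [← Real.log_abs]; exact Real.log_nonneg hs1
      have l4 : L ≤ |Real.log (1 + 4 * r) + Real.log (1 + 4 * s)| := by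
        linarith [le_abs_self (Real.log (1 + 4 * r) + Real.log (1 + 4 * s))]
      nlinarith [mul_le_mul_of_nonneg_left e4 hL0, abs_nonneg σ,
        mul_le_mul_of_nonneg_right l4 (abs_nonneg (ρ + 4 * σ))]

lemma klv_rint {α β : Type*} [MeasurableSpace α] [MeasurableSpace β] {μ : Measure α}
    {ν : Measure β} [SFinite μ] [SFinite ν] (ρ : α × β → ℝ) (hρ : Integrable ρ (μ.prod ν))
    (hρpos : ∀ p, 0 < ρ p) (b : α → ℝ) (hb : Integrable b μ)
    (r : α → ℝ) (hrm : Measurable r)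
    (hr : ∀ᵐ x ∂μ, |r x| * (∫ y, ρ (x, y) ∂ν) = |b x|) :
    Integrable (fun p => |r p.1| * ρ p) (μ.prod ν) := by
  have hm : AEStronglyMeasurable (fun p => |r p.1| * ρ p) (μ.prod ν) :=
    (Measurable.aestronglyMeasurable (by fun_prop)).mul hρ.aestronglyMeasurable
  rw [integrable_prod_iff hm]
  refine ⟨?_, ?_⟩
  · filter_upwards [hρ.prod_right_ae] with x hx using hx.const_mul _
  · refine hb.abs.congr ?_
    filter_upwards [hr] with x hx
    rw [← hx, ← integral_const_mul]
    congr 1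
    ext y
    rw [Real.norm_eq_abs, abs_of_nonneg (mul_nonneg (abs_nonneg _) (hρpos _).le)]

lemma klv_logdiff (a b h g m : ℝ) (ha : 0 < a) (hg : 0 < g) (hm : m = a + h * b)
    (hne : 1 + h * (b / a) ≠ 0) :
    Real.log (m / g) - Real.log (a / g) = Real.log (1 + h * (b / a)) := by
  have : m / g = (a / g) * (1 + h * (b / a)) := by rw [hm]; field_simp
  rw [this, Real.log_mul (by positivity) hne]; ring

/-- first variation of the KL entropy transport functional: for a positive
probability density `ρ`, positive reference densities `ϱ₁, ϱ₂`, and a compactly supported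
continuous perturbation `σ` (assuming the integrability needed to differentiate under the
integral sign), `d/dh E(ρ + hσ)` at `h = 0` equals
`∬ (2Λ + c + Λ log(ρ₁/ϱ₁) + Λ log(ρ₂/ϱ₂)) σ`. -/
theorem EfunKL_first_variation {d : ℕ} (Λ : ℝ) (hΛ : 0 < Λ)
    (c : EuclideanSpace ℝ (Fin d) × EuclideanSpace ℝ (Fin d) → ℝ)
    (hclsc : LowerSemicontinuous c) (hc0 : ∀ p, 0 ≤ c p)
    (ϱ₁ ϱ₂ : EuclideanSpace ℝ (Fin d) → ℝ)
    (hϱ₁pos : ∀ x, 0 < ϱ₁ x) (hϱ₂pos : ∀ x, 0 < ϱ₂ x)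
    (hϱ₁meas : Measurable ϱ₁) (hϱ₂meas : Measurable ϱ₂)
    (hϱ₁prob : ∫ x, ϱ₁ x = 1) (hϱ₂prob : ∫ x, ϱ₂ x = 1)
    (ρ : EuclideanSpace ℝ (Fin d) × EuclideanSpace ℝ (Fin d) → ℝ)
    (hρpos : ∀ p, 0 < ρ p) (hρmeas : Measurable ρ) (hρprob : ∫ p, ρ p = 1)
    (σ : EuclideanSpace ℝ (Fin d) × EuclideanSpace ℝ (Fin d) → ℝ)
    (hσcont : Continuous σ) (hσsupp : HasCompactSupport σ)
    -- integrability sufficient to differentiate under the integral sign: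
    (hint : ∀ h : ℝ, Integrable (fun p =>
      (c p + Λ * Real.log (marg1 (fun q => ρ q + h * σ q) p.1 / ϱ₁ p.1)
        + Λ * Real.log (marg2 (fun q => ρ q + h * σ q) p.2 / ϱ₂ p.2)) * (ρ p + h * σ p)))
    (hint' : Integrable (fun p =>
      (2 * Λ + c p + Λ * Real.log (marg1 ρ p.1 / ϱ₁ p.1)
        + Λ * Real.log (marg2 ρ p.2 / ϱ₂ p.2)) * σ p)) :
    HasDerivAt (fun h : ℝ => EfunKL Λ c ϱ₁ ϱ₂ (fun p => ρ p + h * σ p))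
      (∫ p, (2 * Λ + c p + Λ * Real.log (marg1 ρ p.1 / ϱ₁ p.1)
        + Λ * Real.log (marg2 ρ p.2 / ϱ₂ p.2)) * σ p) 0 := by
  have hρi : Integrable ρ := Integrable.of_integral_ne_zero (by rw [hρprob]; norm_num)
  have hσi : Integrable σ := hσcont.integrable_of_hasCompactSupport hσsupp
  have hσm : Measurable σ := hσcont.measurable
  have hwm : ∀ h : ℝ, Measurable (fun q => ρ q + h * σ q) := fun h => by fun_prop
  have hwi : ∀ h : ℝ, Integrable (fun q => ρ q + h * σ q) := fun h => hρi.add (hσi.const_mul h)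
  have m1 : ∀ f : EuclideanSpace ℝ (Fin d) × EuclideanSpace ℝ (Fin d) → ℝ, Measurable f →
      Measurable (marg1 f) := fun f hf => hf.stronglyMeasurable.integral_prod_right'.measurable
  have m2 : ∀ f : EuclideanSpace ℝ (Fin d) × EuclideanSpace ℝ (Fin d) → ℝ, Measurable f →
      Measurable (marg2 f) := fun f hf => hf.stronglyMeasurable.integral_prod_left'.measurable
  have ha1 : ∀ᵐ x, 0 < marg1 ρ x := by
    filter_upwards [hρi.prod_right_ae] with x hx
    unfold marg1
    rw [integral_pos_iff_support_of_nonneg (fun y => (hρpos _).le) hx]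
    have : Function.support (fun y => ρ (x, y)) = Set.univ := by
      ext y; simp [(hρpos (x, y)).ne']
    rw [this]
    exact Measure.measure_univ_pos.2 (NeZero.ne _)
  have ha2 : ∀ᵐ x, 0 < marg2 ρ x := by
    filter_upwards [hρi.prod_left_ae] with x hx
    unfold marg2
    rw [integral_pos_iff_support_of_nonneg (fun y => (hρpos _).le) hx]
    have : Function.support (fun y => ρ (y, x)) = Set.univ := by
      ext y; simp [(hρpos (y, x)).ne']
    rw [this]
    exact Measure.measure_univ_pos.2 (NeZero.ne _)
  have hm1 : ∀ h : ℝ, ∀ᵐ x, marg1 (fun q => ρ q + h * σ q) x = marg1 ρ x + h * marg1 σ x := by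
    intro h
    filter_upwards [hρi.prod_right_ae, hσi.prod_right_ae] with x hx hx'
    unfold marg1
    rw [integral_add hx (hx'.const_mul h), integral_const_mul]
  have hm2 : ∀ h : ℝ, ∀ᵐ x, marg2 (fun q => ρ q + h * σ q) x = marg2 ρ x + h * marg2 σ x := by
    intro h
    filter_upwards [hρi.prod_left_ae, hσi.prod_left_ae] with x hx hx'
    unfold marg2
    rw [integral_add hx (hx'.const_mul h), integral_const_mul]
  have hb1i : Integrable (marg1 σ) := hσi.integral_prod_left
  have hb2i : Integrable (marg2 σ) := hσi.integral_prod_right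
  have hb1I : ∫ x, marg1 σ x = ∫ p, σ p := (integral_prod _ hσi).symm
  have hb2I : ∫ x, marg2 σ x = ∫ p, σ p := (integral_prod_symm _ hσi).symm
  obtain ⟨A, hAd⟩ : ∃ A : ℝ → EuclideanSpace ℝ (Fin d) → ℝ, A = fun h x =>
    Real.log (marg1 (fun q => ρ q + h * σ q) x / ϱ₁ x) - Real.log (marg1 ρ x / ϱ₁ x) := ⟨_, rfl⟩
  obtain ⟨B, hBd⟩ : ∃ B : ℝ → EuclideanSpace ℝ (Fin d) → ℝ, B = fun h x =>
    Real.log (marg2 (fun q => ρ q + h * σ q) x / ϱ₂ x) - Real.log (marg2 ρ x / ϱ₂ x) := ⟨_, rfl⟩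
  have hAm : ∀ h, Measurable (A h) := fun h => by
    have e1 := m1 _ (hwm h)
    have e2 := m1 _ hρmeas
    rw [hAd]; fun_prop
  have hBm : ∀ h, Measurable (B h) := fun h => by
    have e1 := m2 _ (hwm h)
    have e2 := m2 _ hρmeas
    rw [hBd]; fun_prop
  have hA : ∀ h : ℝ, ∀ᵐ x, 1 + h * (marg1 σ x / marg1 ρ x) ≠ 0 →
      A h x = Real.log (1 + h * (marg1 σ x / marg1 ρ x)) := by
    intro h
    filter_upwards [ha1, hm1 h] with x hx hx' hne
    rw [hAd]
    exact klv_logdiff _ _ _ _ _ hx (hϱ₁pos x) hx' hne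
  have hB : ∀ h : ℝ, ∀ᵐ x, 1 + h * (marg2 σ x / marg2 ρ x) ≠ 0 →
      B h x = Real.log (1 + h * (marg2 σ x / marg2 ρ x)) := by
    intro h
    filter_upwards [ha2, hm2 h] with x hx hx' hne
    rw [hBd]
    exact klv_logdiff _ _ _ _ _ hx (hϱ₂pos x) hx' hne
  have hint0 : Integrable (fun p => (c p + Λ * Real.log (marg1 ρ p.1 / ϱ₁ p.1)
        + Λ * Real.log (marg2 ρ p.2 / ϱ₂ p.2)) * ρ p) := by simpa using hint 0
  have hD : ∀ h : ℝ, Integrable (fun p => (A h p.1 + B h p.2) * (ρ p + h * σ p)) := by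
    intro h
    have := ((((hint h).sub hint0).sub (hint'.const_mul h)).add (hσi.const_mul (2 * Λ * h))).const_mul Λ⁻¹
    refine this.congr (ae_of_all _ fun p => ?_)
    simp only [Pi.add_apply, Pi.sub_apply, hAd, hBd]
    field_simp
    ring
  have fst_ae : ∀ {P : EuclideanSpace ℝ (Fin d) → Prop}, (∀ᵐ x, P x) →
      ∀ᵐ p : EuclideanSpace ℝ (Fin d) × EuclideanSpace ℝ (Fin d), P p.1 := fun h =>
    Measure.quasiMeasurePreserving_fst.ae h
  have snd_ae : ∀ {P : EuclideanSpace ℝ (Fin d) → Prop}, (∀ᵐ x, P x) →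
      ∀ᵐ p : EuclideanSpace ℝ (Fin d) × EuclideanSpace ℝ (Fin d), P p.2 := fun h =>
    Measure.quasiMeasurePreserving_snd.ae h
  have a1m := m1 _ hρmeas
  have a2m := m2 _ hρmeas
  have b1m := m1 _ hσm
  have b2m := m2 _ hσm
  have r1 : Integrable (fun p : EuclideanSpace ℝ (Fin d) × EuclideanSpace ℝ (Fin d) =>
      |marg1 σ p.1 / marg1 ρ p.1| * ρ p) := by
    refine klv_rint ρ hρi hρpos (marg1 σ) hb1i (fun x => marg1 σ x / marg1 ρ x) (by fun_prop) ?_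
    filter_upwards [ha1] with x hx
    change _ * marg1 ρ x = _
    rw [abs_div, abs_of_pos hx]; field_simp
  have r2 : Integrable (fun p : EuclideanSpace ℝ (Fin d) × EuclideanSpace ℝ (Fin d) =>
      |marg2 σ p.2 / marg2 ρ p.2| * ρ p) := by
    refine (klv_rint (fun p => ρ p.swap) hρi.swap (fun p => hρpos _) (marg2 σ) hb2i
      (fun x => marg2 σ x / marg2 ρ x) (by fun_prop) ?_).swap
    filter_upwards [ha2] with x hx
    change _ * marg2 ρ x = _
    rw [abs_div, abs_of_pos hx]; field_simp
  have hD1 : Integrable (fun p => (A 1 p.1 + B 1 p.2) * (ρ p + σ p)) := by simpa using hD 1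
  have L1 : Integrable (fun p : EuclideanSpace ℝ (Fin d) × EuclideanSpace ℝ (Fin d) =>
      Real.log (1 + |marg1 σ p.1 / marg1 ρ p.1|) * σ p) := by
    refine (((hD1.abs.add (hD 4).abs).add ((hρi.add hσi.abs).const_mul 3)).add r1).mono'
      (Measurable.aestronglyMeasurable (by fun_prop)) ?_
    filter_upwards [fst_ae (hA 1), fst_ae (hA 4), snd_ae (hB 1), snd_ae (hB 4)] with p q1 q2 q3 q4
    rw [one_mul] at q1 q3
    exact klv_pt _ _ _ _ _ _ _ _ (hρpos p) q1 q3 q2 q4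
  have L2 : Integrable (fun p : EuclideanSpace ℝ (Fin d) × EuclideanSpace ℝ (Fin d) =>
      Real.log (1 + |marg2 σ p.2 / marg2 ρ p.2|) * σ p) := by
    refine (((hD1.abs.add (hD 4).abs).add ((hρi.add hσi.abs).const_mul 3)).add r2).mono'
      (Measurable.aestronglyMeasurable (by fun_prop)) ?_
    filter_upwards [fst_ae (hA 1), fst_ae (hA 4), snd_ae (hB 1), snd_ae (hB 4)] with p q1 q2 q3 q4
    rw [one_mul] at q1 q3
    have := klv_pt _ _ _ (σ p) _ _ _ _ (hρpos p) q3 q1 q4 q2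
    rw [add_comm (B 1 p.2), add_comm (B 4 p.2)] at this
    exact this
  have L1' : Integrable (fun x => Real.log (1 + |marg1 σ x / marg1 ρ x|) * marg1 σ x) := by
    refine L1.integral_prod_left.congr (ae_of_all _ fun x => ?_)
    exact integral_const_mul (Real.log (1 + |marg1 σ x / marg1 ρ x|)) (fun y => σ (x, y))
  have L2' : Integrable (fun x => Real.log (1 + |marg2 σ x / marg2 ρ x|) * marg2 σ x) := by
    refine L2.integral_prod_right.congr (ae_of_all _ fun x => ?_)
    exact integral_const_mul (Real.log (1 + |marg2 σ x / marg2 ρ x|)) (fun y => σ (y, x))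
  obtain ⟨I1, D1⟩ := klv_deriv _ _ a1m b1m ha1 hb1i L1'
  obtain ⟨I2, D2⟩ := klv_deriv _ _ a2m b2m ha2 hb2i L2'
  rw [hb1I] at D1
  rw [hb2I] at D2
  have hQ : ∀ h : ℝ, |h| ≤ 1 → ∫ p, (A h p.1 + B h p.2) * (ρ p + h * σ p) =
      (∫ x, Real.log (1 + h * (marg1 σ x / marg1 ρ x)) * (marg1 ρ x + h * marg1 σ x))
      + ∫ x, Real.log (1 + h * (marg2 σ x / marg2 ρ x)) * (marg2 ρ x + h * marg2 σ x) := by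
    intro h hh
    refine klv_trunc (fun p => ρ p + h * σ p) (hwi h) (A h) _ (B h) _ (hAm h) (hBm h)
      (fun x => marg1 ρ x + h * marg1 σ x) (fun x => marg2 ρ x + h * marg2 σ x) ?_ ?_ (hD h)
      ?_ ?_ (I1 h hh) (I2 h hh)
    · filter_upwards [hm1 h] with x hx using hx.symm
    · filter_upwards [hm2 h] with x hx using hx.symm
    · filter_upwards [hA h, ha1] with x hx hp hne
      refine hx fun h0 => hne ?_
      have : marg1 ρ x + h * marg1 σ x = marg1 ρ x * (1 + h * (marg1 σ x / marg1 ρ x)) := by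
        field_simp
      rw [this, h0, mul_zero]
    · filter_upwards [hB h, ha2] with x hx hp hne
      refine hx fun h0 => hne ?_
      have : marg2 ρ x + h * marg2 σ x = marg2 ρ x * (1 + h * (marg2 σ x / marg2 ρ x)) := by
        field_simp
      rw [this, h0, mul_zero]
  set K := ∫ p, (2 * Λ + c p + Λ * Real.log (marg1 ρ p.1 / ϱ₁ p.1)
        + Λ * Real.log (marg2 ρ p.2 / ϱ₂ p.2)) * σ p with hK
  have hE : ∀ h : ℝ, |h| ≤ 1 → EfunKL Λ c ϱ₁ ϱ₂ (fun p => ρ p + h * σ p) =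
      (∫ p, (c p + Λ * Real.log (marg1 ρ p.1 / ϱ₁ p.1)
        + Λ * Real.log (marg2 ρ p.2 / ϱ₂ p.2)) * ρ p) + h * (K - 2 * Λ * ∫ p, σ p)
      + Λ * ((∫ x, Real.log (1 + h * (marg1 σ x / marg1 ρ x)) * (marg1 ρ x + h * marg1 σ x))
      + ∫ x, Real.log (1 + h * (marg2 σ x / marg2 ρ x)) * (marg2 ρ x + h * marg2 σ x)) := by
    intro h hh
    have i3 : Integrable (fun p => h * ((2 * Λ + c p + Λ * Real.log (marg1 ρ p.1 / ϱ₁ p.1)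
        + Λ * Real.log (marg2 ρ p.2 / ϱ₂ p.2)) * σ p - 2 * Λ * σ p)) :=
      (hint'.sub (hσi.const_mul _)).const_mul h
    have i4 : Integrable (fun p => (c p + Λ * Real.log (marg1 ρ p.1 / ϱ₁ p.1)
        + Λ * Real.log (marg2 ρ p.2 / ϱ₂ p.2)) * ρ p
        + h * ((2 * Λ + c p + Λ * Real.log (marg1 ρ p.1 / ϱ₁ p.1)
        + Λ * Real.log (marg2 ρ p.2 / ϱ₂ p.2)) * σ p - 2 * Λ * σ p)) := hint0.add i3
    rw [← hQ h hh, hK, ← integral_const_mul (2 * Λ), ← integral_sub hint' (hσi.const_mul _),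
      ← integral_const_mul h, ← integral_const_mul Λ,
      ← integral_add hint0 i3,
      ← integral_add i4 ((hD h).const_mul Λ)]
    unfold EfunKL
    congr 1
    ext p
    simp only [hAd, hBd]
    ring
  have hfin := (((hasDerivAt_id (0 : ℝ)).mul_const (K - 2 * Λ * ∫ p, σ p)).const_add
    (∫ p, (c p + Λ * Real.log (marg1 ρ p.1 / ϱ₁ p.1)
        + Λ * Real.log (marg2 ρ p.2 / ϱ₂ p.2)) * ρ p)).add ((D1.add D2).const_mul Λ)
  have e : 1 * (K - 2 * Λ * ∫ p, σ p) + Λ * ((∫ p, σ p) + ∫ p, σ p) = K := by ring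
  rw [e] at hfin
  refine hfin.congr_of_eventuallyEq ?_
  filter_upwards [Metric.ball_mem_nhds (0 : ℝ) one_pos] with h hh
  exact hE h (by simpa using (Metric.mem_ball.1 hh).le)
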